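/- arXiv:1509.07138 — 3 statements merged into one kernel-verified Lean document; each statement's English description precedes it below -/
import Mathlib

section
/- Assume 2m ≤ n. Let N be a potential table and N' = N + Δ with Δ ∈ T0 = {(−1,1,0,0), (0,0,−1,1)}, both N and N' being potential tables on n units. Fix a rational threshold t. If τ(N) ≤ t and τ(N') ≤ t, then for any potential outcomes (y1', y0') with table N' and any potential outcomes (y1, y0) with table N, p2(y1', y0') ≥ p2(y1, y0); i.e., p2(N') ≥ p2(N). -/
open Finset

/-- Number of treated units with outcome 1: `n11(S) = #{j ∈ S : y1 j = 1}`. -/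
def nObs11 {n : ℕ} (y1 : Fin n → Bool) (S : Finset (Fin n)) : ℕ :=
  (S.filter (fun j => y1 j = true)).card

/-- Number of treated units with outcome 0: `n10(S) = #{j ∈ S : y1 j = 0}`. -/
def nObs10 {n : ℕ} (y1 : Fin n → Bool) (S : Finset (Fin n)) : ℕ :=
  (S.filter (fun j => y1 j = false)).card

/-- Number of control units with outcome 1: `n01(S) = #{j ∉ S : y0 j = 1}`. -/
def nObs01 {n : ℕ} (y0 : Fin n → Bool) (S : Finset (Fin n)) : ℕ :=
  (Sᶜ.filter (fun j => y0 j = true)).card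

/-- Number of control units with outcome 0: `n00(S) = #{j ∉ S : y0 j = 0}`. -/
def nObs00 {n : ℕ} (y0 : Fin n → Bool) (S : Finset (Fin n)) : ℕ :=
  (Sᶜ.filter (fun j => y0 j = false)).card

/-- The potential table `(N11, N10, N01, N00)` of potential outcomes `(y1, y0)`. -/
def potTable {n : ℕ} (y1 y0 : Fin n → Bool) : ℕ × ℕ × ℕ × ℕ :=
  ((univ.filter (fun j => y1 j = true ∧ y0 j = true)).card,
   (univ.filter (fun j => y1 j = true ∧ y0 j = false)).card,
   (univ.filter (fun j => y1 j = false ∧ y0 j = true)).card,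
   (univ.filter (fun j => y1 j = false ∧ y0 j = false)).card)

/-- The observed table `(n11(S), n10(S), n01(S), n00(S))`. -/
def obsTable {n : ℕ} (y1 y0 : Fin n → Bool) (S : Finset (Fin n)) : ℕ × ℕ × ℕ × ℕ :=
  (nObs11 y1 S, nObs10 y1 S, nObs01 y0 S, nObs00 y0 S)

/-- The estimator `τ̂(S) = n11(S)/m - n01(S)/(n - m)`. -/
def tauHat {n : ℕ} (m : ℕ) (y1 y0 : Fin n → Bool) (S : Finset (Fin n)) : ℚ :=
  (nObs11 y1 S : ℚ) / m - (nObs01 y0 S : ℚ) / ((n : ℚ) - m)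

/-- The average causal effect `τ = (N10 - N01)/n` of potential outcomes `(y1, y0)`. -/
def tauPO {n : ℕ} (y1 y0 : Fin n → Bool) : ℚ :=
  (((potTable y1 y0).2.1 : ℚ) - ((potTable y1 y0).2.2.1 : ℚ)) / n

/-- One-sided p-value at threshold `t`:
`#{S : |S| = m, τ̂(S) ≥ t} / C(n, m)`. -/
def pOne {n : ℕ} (m : ℕ) (t : ℚ) (y1 y0 : Fin n → Bool) : ℚ :=
  ((((univ : Finset (Fin n)).powersetCard m).filter
      (fun S => t ≤ tauHat m y1 y0 S)).card : ℚ) / (n.choose m)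

/-- Two-sided p-value at threshold `t`:
`#{S : |S| = m, |τ̂(S) - τ| ≥ |t - τ|} / C(n, m)` where `τ` is the average causal
effect of `(y1, y0)`. -/
def pTwo {n : ℕ} (m : ℕ) (t : ℚ) (y1 y0 : Fin n → Bool) : ℚ :=
  ((((univ : Finset (Fin n)).powersetCard m).filter
      (fun S => |t - tauPO y1 y0| ≤ |tauHat m y1 y0 S - tauPO y1 y0|)).card : ℚ) / (n.choose m)

/-- Canonical treatment potential outcomes realizing a table: first `N11 + N10` units
have `y1 = 1`. -/
def canY1 (n N11 N10 : ℕ) : Fin n → Bool :=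
  fun j => decide (j.val < N11 + N10)

/-- Canonical control potential outcomes realizing a table: first `N11` units and the
`N01` units following the first `N11 + N10` ones have `y0 = 1`. -/
def canY0 (n N11 N10 N01 : ℕ) : Fin n → Bool :=
  fun j => decide (j.val < N11 ∨ (N11 + N10 ≤ j.val ∧ j.val < N11 + N10 + N01))

/-- One-sided p-value of a potential table `N = (N11, N10, N01, N00)`, well defined
since the p-value depends on the potential outcomes only through the table. -/
def pOneTable (n m : ℕ) (t : ℚ) (N11 N10 N01 N00 : ℕ) : ℚ :=
  pOne m t (canY1 n N11 N10) (canY0 n N11 N10 N01)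

/-- Two-sided p-value of a potential table `N = (N11, N10, N01, N00)`:
`#{S : |S| = m, |τ̂(S) - τ(N)| ≥ |t - τ(N)|} / C(n, m)` with `τ(N) = (N10 - N01)/n`,
well defined since it depends on the potential outcomes only through the table. -/
def pTwoTable (n m : ℕ) (t : ℚ) (N11 N10 N01 N00 : ℕ) : ℚ :=
  ((((univ : Finset (Fin n)).powersetCard m).filter
      (fun S => |t - ((N10 : ℚ) - N01) / n| ≤
        |tauHat m (canY1 n N11 N10) (canY0 n N11 N10 N01) S - ((N10 : ℚ) - N01) / n|)).card : ℚ)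
    / (n.choose m)

/-- A potential table `N` is compatible with an observed table `obs` if some potential
outcomes with table `N` produce `obs` under some assignment of `m` units to treatment. -/
def Compatible (n m : ℕ) (N obs : ℕ × ℕ × ℕ × ℕ) : Prop :=
  ∃ (y1 y0 : Fin n → Bool) (S : Finset (Fin n)),
    S.card = m ∧ potTable y1 y0 = N ∧ obsTable y1 y0 S = obs


/-- Potential outcomes with the same potential table differ by a permutation of the units. -/
theorem exists_perm_of_potTable_eq {n : ℕ} {y1 y0 y1' y0' : Fin n → Bool}
    (h : potTable y1 y0 = potTable y1' y0') :
    ∃ σ : Equiv.Perm (Fin n), ∀ j, y1' (σ j) = y1 j ∧ y0' (σ j) = y0 j := by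
  simp only [potTable, Prod.mk.injEq] at h
  obtain ⟨h11, h10, h01, h00⟩ := h
  have hcard : ∀ c : Bool × Bool, Fintype.card {j // (y1 j, y0 j) = c} =
      Fintype.card {j // (y1' j, y0' j) = c} := by
    rintro ⟨_ | _, _ | _⟩ <;> simpa [Fintype.card_subtype]
  let e : ∀ c : Bool × Bool, {j // (y1 j, y0 j) = c} ≃ {j // (y1' j, y0' j) = c} :=
    fun c => Fintype.equivOfCardEq (hcard c)
  refine ⟨Equiv.ofFiberEquiv e, fun j => ?_⟩
  simpa using Equiv.ofFiberEquiv_map e j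

/-- Relabelling the units leaves the estimator unchanged. -/
theorem tauHat_map_perm {n : ℕ} (m : ℕ) {y1 y0 y1' y0' : Fin n → Bool} (σ : Equiv.Perm (Fin n))
    (hσ : ∀ j, y1' (σ j) = y1 j ∧ y0' (σ j) = y0 j) (S : Finset (Fin n)) :
    tauHat m y1' y0' (S.map σ.toEmbedding) = tauHat m y1 y0 S := by
  have h1 : nObs11 y1' (S.map σ.toEmbedding) = nObs11 y1 S := by
    simp [nObs11, Finset.filter_map, hσ]
  have hc : (S.map σ.toEmbedding)ᶜ = Sᶜ.map σ.toEmbedding := by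
    ext j
    simp [Finset.mem_map_equiv]
  have h0 : nObs01 y0' (S.map σ.toEmbedding) = nObs01 y0 S := by
    simp only [nObs01, hc]
    simp [Finset.filter_map, hσ]
  simp only [tauHat, h1, h0]

/-- The two-sided p-values of potential outcomes with the same potential table are comparable
(hence, by symmetry, equal). -/
theorem pTwo_le_of_potTable_eq {n : ℕ} (m : ℕ) (t : ℚ) {y1 y0 y1' y0' : Fin n → Bool}
    (h : potTable y1 y0 = potTable y1' y0') : pTwo m t y1 y0 ≤ pTwo m t y1' y0' := by
  obtain ⟨σ, hσ⟩ := exists_perm_of_potTable_eq h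
  have hτ : tauPO y1' y0' = tauPO y1 y0 := by simp only [tauPO, h]
  unfold pTwo
  gcongr ?_ / _
  norm_cast
  refine Finset.card_le_card_of_injOn (fun S => S.map σ.toEmbedding) (fun S hS => ?_)
    (Finset.map_injective _).injOn
  simpa [hτ, tauHat_map_perm m σ hσ] using hS

/-- Changing the control outcome of a unit from `1` to `0` raises the estimator by at least `0`
and at most `1 / (n - m)`. -/
theorem tauHat_update_false {n m : ℕ} (hmn : m < n) (y1 y0 : Fin n → Bool) (a : Fin n)
    (S : Finset (Fin n)) :
    tauHat m y1 y0 S ≤ tauHat m y1 (Function.update y0 a false) S ∧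
      tauHat m y1 (Function.update y0 a false) S ≤ tauHat m y1 y0 S + 1 / ((n : ℚ) - m) := by
  have hpos : (0 : ℚ) < (n : ℚ) - m := sub_pos.2 (by exact_mod_cast hmn)
  have herase : Sᶜ.filter (fun j => Function.update y0 a false j = true) =
      (Sᶜ.filter (fun j => y0 j = true)).erase a := by
    ext j
    by_cases hj : j = a <;> simp [Function.update_apply, hj]
  have hle : nObs01 (Function.update y0 a false) S ≤ nObs01 y0 S := by
    simp only [nObs01, herase]
    exact Finset.card_erase_le
  have hge : nObs01 y0 S ≤ nObs01 (Function.update y0 a false) S + 1 := by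
    simp only [nObs01, herase]
    have := Finset.pred_card_le_card_erase (s := Sᶜ.filter (fun j => y0 j = true)) (a := a)
    omega
  have hle' : (nObs01 (Function.update y0 a false) S : ℚ) / ((n : ℚ) - m) ≤
      (nObs01 y0 S : ℚ) / ((n : ℚ) - m) := by gcongr
  have hge' : (nObs01 y0 S : ℚ) / ((n : ℚ) - m) ≤
      (nObs01 (Function.update y0 a false) S : ℚ) / ((n : ℚ) - m) + 1 / ((n : ℚ) - m) := by
    rw [← add_div]
    gcongr
    exact_mod_cast hge
  simp only [tauHat]
  constructor <;> linarith

/-- Changing the control outcome of a unit from `1` to `0` moves that unit to another cell of the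
potential table. -/
theorem potTable_update_false {n : ℕ} (y1 y0 : Fin n → Bool) (a : Fin n) (ha : y0 a = true)
    (N11 N10 N01 N00 : ℕ) (hy : potTable y1 y0 = (N11, N10, N01, N00)) :
    potTable y1 (Function.update y0 a false) =
      if y1 a then (N11 - 1, N10 + 1, N01, N00) else (N11, N10, N01 - 1, N00 + 1) := by
  have herase : ∀ b, univ.filter (fun j => y1 j = b ∧ Function.update y0 a false j = true) =
      (univ.filter (fun j => y1 j = b ∧ y0 j = true)).erase a := by
    intro b
    ext j
    by_cases hj : j = a <;> simp [Function.update_apply, hj]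
  have hinsert : univ.filter (fun j => y1 j = y1 a ∧ Function.update y0 a false j = false) =
      insert a (univ.filter (fun j => y1 j = y1 a ∧ y0 j = false)) := by
    ext j
    by_cases hj : j = a <;> simp [Function.update_apply, hj]
  have hsame : ∀ b, b ≠ y1 a →
      univ.filter (fun j => y1 j = b ∧ Function.update y0 a false j = false) =
        univ.filter (fun j => y1 j = b ∧ y0 j = false) := by
    intro b hb
    ext j
    by_cases hj : j = a <;> simp [Function.update_apply, hj, hb.symm]
  simp only [potTable, Prod.mk.injEq] at hy
  obtain ⟨rfl, rfl, rfl, rfl⟩ := hy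
  cases h : y1 a
  · rw [h] at hinsert hsame
    simp [potTable, herase, hinsert, hsame true, ha, h]
  · rw [h] at hinsert hsame
    simp [potTable, herase, hinsert, hsame false, ha, h]

/-- If at most half of the units are treated, changing the control outcome of a unit from `1` to
`0` does not decrease the two-sided p-value, as long as the effect does not exceed `t`. -/
theorem pTwo_le_update_false {n m : ℕ} (hm : 0 < m) (h2m : 2 * m ≤ n) {t : ℚ}
    {y1 y0 : Fin n → Bool} {a : Fin n}
    (hτ : tauPO y1 (Function.update y0 a false) = tauPO y1 y0 + 1 / n)
    (ht : tauPO y1 (Function.update y0 a false) ≤ t) :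
    pTwo m t y1 y0 ≤ pTwo m t y1 (Function.update y0 a false) := by
  have hn : (0 : ℚ) < n := by exact_mod_cast (by omega : 0 < n)
  have h2m' : (2 : ℚ) * m ≤ n := by exact_mod_cast h2m
  have hpos : (0 : ℚ) < (n : ℚ) - m := sub_pos.2 (by exact_mod_cast (by omega : m < n))
  have hstep : 1 / ((n : ℚ) - m) ≤ 2 * (1 / n) := by
    rw [mul_one_div, div_le_div_iff₀ hpos hn]
    linarith
  have hn' : (0 : ℚ) < 1 / n := by positivity
  unfold pTwo
  gcongr ?_ / _
  norm_cast
  refine Finset.card_le_card fun S hS => ?_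
  rw [Finset.mem_filter] at hS ⊢
  refine ⟨hS.1, ?_⟩
  obtain ⟨hlo, hhi⟩ := tauHat_update_false (by omega : m < n) y1 y0 a S
  have hS' := hS.2
  rw [abs_of_nonneg (by linarith), le_abs] at hS' ⊢
  rcases hS' with h | h
  · left
    linarith
  · right
    linarith

/-- Lemma A.3: if `2m ≤ n`, `N' = N + Δ` with `Δ ∈ T₀`, and both
`τ(N) ≤ t` and `τ(N') ≤ t`, then `p2(N') ≥ p2(N)`, for any potential outcomes
realizing the two tables. -/
theorem pTwo_mono_onemove_unbalanced (n m : ℕ) (hm : 0 < m) (h2m : 2 * m ≤ n) (t : ℚ)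
    (Δ : ℤ × ℤ × ℤ × ℤ) (hΔ : Δ = (-1, 1, 0, 0) ∨ Δ = (0, 0, -1, 1))
    (N11 N10 N01 N00 N11' N10' N01' N00' : ℕ)
    (hN : N11 + N10 + N01 + N00 = n) (hN' : N11' + N10' + N01' + N00' = n)
    (hadd : (N11' : ℤ) = (N11 : ℤ) + Δ.1 ∧ (N10' : ℤ) = (N10 : ℤ) + Δ.2.1 ∧
            (N01' : ℤ) = (N01 : ℤ) + Δ.2.2.1 ∧ (N00' : ℤ) = (N00 : ℤ) + Δ.2.2.2)
    (htau : ((N10 : ℚ) - N01) / n ≤ t) (htau' : ((N10' : ℚ) - N01') / n ≤ t)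
    (y1 y0 y1' y0' : Fin n → Bool)
    (hy : potTable y1 y0 = (N11, N10, N01, N00))
    (hy' : potTable y1' y0' = (N11', N10', N01', N00')) :
    pTwo m t y1 y0 ≤ pTwo m t y1' y0' := by
  obtain ⟨h11, h10, h01, h00⟩ := hadd
  have hcell : ∃ a, y0 a = true ∧
      potTable y1 (Function.update y0 a false) = (N11', N10', N01', N00') := by
    have hy' := hy
    simp only [potTable, Prod.mk.injEq] at hy'
    rcases hΔ with rfl | rfl <;> dsimp only at h11 h10 h01 h00
    · have hpos : 0 < (univ.filter (fun j => y1 j = true ∧ y0 j = true)).card := by omega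
      obtain ⟨a, ha⟩ := Finset.card_pos.1 hpos
      simp only [Finset.mem_filter, Finset.mem_univ, true_and] at ha
      refine ⟨a, ha.2, ?_⟩
      rw [potTable_update_false y1 y0 a ha.2 _ _ _ _ hy, if_pos ha.1]
      simp only [Prod.mk.injEq]
      omega
    · have hpos : 0 < (univ.filter (fun j => y1 j = false ∧ y0 j = true)).card := by omega
      obtain ⟨a, ha⟩ := Finset.card_pos.1 hpos
      simp only [Finset.mem_filter, Finset.mem_univ, true_and] at ha
      refine ⟨a, ha.2, ?_⟩
      rw [potTable_update_false y1 y0 a ha.2 _ _ _ _ hy, if_neg (by simp [ha.1])]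
      simp only [Prod.mk.injEq]
      omega
  obtain ⟨a, -, hz⟩ := hcell
  have hdiff : (N10' : ℤ) - N01' = N10 - N01 + 1 := by
    rcases hΔ with rfl | rfl <;> dsimp only at h10 h01 <;> omega
  have hdiff' : (N10' : ℚ) - N01' = N10 - N01 + 1 := by exact_mod_cast hdiff
  refine (pTwo_le_update_false (a := a) hm h2m ?_ ?_).trans
    (pTwo_le_of_potTable_eq m t (hz.trans hy'.symm))
  · simp only [tauPO, hz, hy, hdiff']
    ring
  · simpa only [tauPO, hz] using htau'
end

section
/- Assume 2m ≤ n, fix α ∈ (0,1) and a rational t. For nonnegative integers N11, N01 with N11 + N01 ≤ n, define N̲10(N11, N01) as the minimum N10 ∈ {0, …, n − N11 − N01} such that the potential table N = (N11, N10, N01, n − N11 − N10 − N01) satisfies p2(N) ≥ α and τ(N) ≤ t; if no such N10 exists, set N̲10(N11, N01) = ⌊N01 + n·t⌋ + 1. Then N̲10 is monotone in its second argument: if N01 ≤ N01' and N11 + N01' ≤ n, then N̲10(N11, N01) ≤ N̲10(N11, N01'). -/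
open Finset

/-- `N̲10(N11, N01)`: the minimum `N10 ∈ {0, …, n - N11 - N01}` such that the
potential table `(N11, N10, N01, n - N11 - N10 - N01)` satisfies `p2(N) ≥ α` and
`τ(N) ≤ t`; if no such `N10` exists, it is `⌊N01 + n·t⌋ + 1`. -/
def lowN10Two (n m : ℕ) (t α : ℚ) (N11 N01 : ℕ) : ℤ :=
  let s := (Finset.range (n - N11 - N01 + 1)).filter
    (fun N10 => α ≤ pTwoTable n m t N11 N10 N01 (n - N11 - N10 - N01) ∧
      ((N10 : ℚ) - N01) / n ≤ t)
  if h : s.Nonempty then ((s.min' h : ℕ) : ℤ) else ⌊(N01 : ℚ) + n * t⌋ + 1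

theorem nObs01_canY0_le_of_le {n : ℕ} (N11 N10 : ℕ) {N01 N01' : ℕ} (h : N01 ≤ N01')
    (S : Finset (Fin n)) :
    nObs01 (canY0 n N11 N10 N01) S ≤ nObs01 (canY0 n N11 N10 N01') S := by
  refine card_le_card fun j hj => ?_
  simp only [canY0, mem_filter, decide_eq_true_eq] at hj ⊢
  exact ⟨hj.1, by omega⟩

theorem nObs01_canY0_add_le {n : ℕ} (N11 N10 N01 d : ℕ) (S : Finset (Fin n)) :
    nObs01 (canY0 n N11 N10 (N01 + d)) S ≤ nObs01 (canY0 n N11 N10 N01) S + d := by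
  let a := N11 + N10 + N01
  calc nObs01 (canY0 n N11 N10 (N01 + d)) S
      = ((Sᶜ.filter (fun j => canY0 n N11 N10 (N01 + d) j = true)).image Fin.val).card :=
        (card_image_of_injective _ Fin.val_injective).symm
    _ ≤ ((Sᶜ.filter (fun j => canY0 n N11 N10 N01 j = true)).image Fin.val ∪ Ico a (a + d)).card := by
        refine card_le_card fun x hx => ?_
        simp only [canY0, mem_image, mem_union, mem_filter, mem_Ico, decide_eq_true_eq] at hx ⊢
        obtain ⟨j, ⟨hjS, hj⟩, rfl⟩ := hx
        by_cases hja : a ≤ j.val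
        · exact .inr ⟨hja, by grind⟩
        · exact .inl ⟨j, ⟨hjS, by grind⟩, rfl⟩
    _ ≤ nObs01 (canY0 n N11 N10 N01) S + d := by
        refine (card_union_le _ _).trans ?_
        rw [card_image_of_injective _ Fin.val_injective, Nat.card_Ico, Nat.add_sub_cancel_left]
        rfl

/-- Replacing `(0, 1)` units by `(0, 0)` units does not decrease the two-sided p-value, as long
as the average causal effect stays at most `t`. -/
theorem pTwoTable_add_le {n m : ℕ} (hm : 0 < m) (h2m : 2 * m ≤ n) (t : ℚ)
    (N11 N10 N01 d N00 N00' : ℕ) (ht : ((N10 : ℚ) - N01) / n ≤ t) :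
    pTwoTable n m t N11 N10 (N01 + d) N00 ≤ pTwoTable n m t N11 N10 N01 N00' := by
  have hm' : (0 : ℚ) < m := by exact_mod_cast hm
  have h2m' : 2 * (m : ℚ) ≤ n := by exact_mod_cast h2m
  have hn : (0 : ℚ) < n := by linarith
  have hnm : (0 : ℚ) < n - m := by linarith
  have hd : (0 : ℚ) ≤ d := by positivity
  have hτ : ((N10 : ℚ) - ((N01 + d : ℕ) : ℚ)) / n = ((N10 : ℚ) - N01) / n - d / n := by
    push_cast
    ring
  have hdn : (0 : ℚ) ≤ d / n := by positivity
  have hstep : (d : ℚ) / (n - m) ≤ 2 * (d / n) := by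
    rw [← mul_div_assoc, div_le_div_iff₀ hnm hn]
    nlinarith
  unfold pTwoTable
  rw [hτ]
  refine div_le_div_of_nonneg_right (Nat.cast_le.2 (card_le_card ?_)) (Nat.cast_nonneg _)
  refine monotone_filter_right _ fun S _ => ?_
  have hlow : (nObs01 (canY0 n N11 N10 N01) S : ℚ) ≤ nObs01 (canY0 n N11 N10 (N01 + d)) S := by
    exact_mod_cast nObs01_canY0_le_of_le N11 N10 (Nat.le_add_right N01 d) S
  have hupp : (nObs01 (canY0 n N11 N10 (N01 + d)) S : ℚ) ≤
      nObs01 (canY0 n N11 N10 N01) S + d := by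
    exact_mod_cast nObs01_canY0_add_le N11 N10 N01 d S
  have hlow' := div_le_div_of_nonneg_right hlow hnm.le
  have hupp' := div_le_div_of_nonneg_right hupp hnm.le
  rw [add_div] at hupp'
  simp only [tauHat]
  rw [abs_of_nonneg (by linarith : 0 ≤ t - ((N10 : ℚ) - N01) / n),
    abs_of_nonneg (by linarith : 0 ≤ t - (((N10 : ℚ) - N01) / n - d / n)), le_abs, le_abs]
  rintro (h | h)
  · left; linarith
  · right; linarith

theorem lowN10Two_le_floor_add_one {n : ℕ} (hn : 0 < n) (m : ℕ) (t α : ℚ) (N11 N01 : ℕ) :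
    lowN10Two n m t α N11 N01 ≤ ⌊(N01 : ℚ) + n * t⌋ + 1 := by
  unfold lowN10Two
  extract_lets s
  split_ifs with h
  · have hmem := (mem_filter.1 (s.min'_mem h)).2.2
    rw [div_le_iff₀ (by exact_mod_cast hn)] at hmem
    have : ((s.min' h : ℕ) : ℤ) ≤ ⌊(N01 : ℚ) + n * t⌋ := by
      rw [Int.le_floor]
      push_cast
      linarith
    omega
  · exact le_rfl

theorem lowN10Two_le_of_mem {n m : ℕ} {t α : ℚ} {N11 N10 N01 : ℕ}
    (hN : N10 < n - N11 - N01 + 1)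
    (hp : α ≤ pTwoTable n m t N11 N10 N01 (n - N11 - N10 - N01))
    (ht : ((N10 : ℚ) - N01) / n ≤ t) :
    lowN10Two n m t α N11 N01 ≤ N10 := by
  unfold lowN10Two
  extract_lets s
  have hmem : N10 ∈ s := mem_filter.2 ⟨mem_range.2 hN, hp, ht⟩
  rw [dif_pos ⟨N10, hmem⟩]
  exact_mod_cast s.min'_le N10 hmem

/-- Theorem 2(1): for `2m ≤ n`, `N̲10(N11, ·)` is monotone. -/
theorem lowN10Two_mono (n m : ℕ) (hm : 0 < m) (h2m : 2 * m ≤ n) (α t : ℚ)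
    (hα : 0 < α ∧ α < 1) (N11 N01 N01' : ℕ) (h01 : N01 ≤ N01') (hsum : N11 + N01' ≤ n) :
    lowN10Two n m t α N11 N01 ≤ lowN10Two n m t α N11 N01' := by
  have hn : 0 < n := by omega
  have hfloor := lowN10Two_le_floor_add_one hn m t α N11 N01
  obtain ⟨d, rfl⟩ := Nat.exists_eq_add_of_le h01
  conv_rhs => unfold lowN10Two
  extract_lets s
  split_ifs with h
  · obtain ⟨hrange, hp, -⟩ := mem_filter.1 (s.min'_mem h)
    rw [mem_range] at hrange
    by_cases ht : ((s.min' h : ℕ) - (N01 : ℚ)) / n ≤ t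
    · exact lowN10Two_le_of_mem (by omega)
        (hp.trans (pTwoTable_add_le hm h2m t N11 _ N01 d _ _ ht)) ht
    · rw [not_le, lt_div_iff₀ (by exact_mod_cast hn)] at ht
      have : ⌊(N01 : ℚ) + n * t⌋ < ((s.min' h : ℕ) : ℤ) := by
        rw [Int.floor_lt]
        push_cast
        linarith
      omega
  · refine hfloor.trans ?_
    gcongr
end

section
/- Let 0 < m < n, fix α ∈ (0,1) and a rational threshold t. For nonnegative integers N11, N01 with N11 + N01 ≤ n, define N̲10¹(N11, N01) as the minimum N10 ∈ {0, …, n − N11 − N01} such that the potential table N = (N11, N10, N01, n − N11 − N10 − N01) satisfies p1(N) ≥ α; if no such N10 exists, set N̲10¹(N11, N01) = n + 1. Then for every potential table N = (N11, N10, N01, N00), one has p1(N) ≥ α if and only if N10 ≥ N̲10¹(N11, N01). -/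
open Finset

/-- `N̲10¹(N11, N01)`: the minimum `N10 ∈ {0, …, n - N11 - N01}` such that the
potential table `(N11, N10, N01, n - N11 - N10 - N01)` satisfies `p1(N) ≥ α`; if no
such `N10` exists, it is `n + 1`. -/
def lowN10One (n m : ℕ) (t α : ℚ) (N11 N01 : ℕ) : ℤ :=
  let s := (Finset.range (n - N11 - N01 + 1)).filter
    (fun N10 => α ≤ pOneTable n m t N11 N10 N01 (n - N11 - N10 - N01))
  if h : s.Nonempty then ((s.min' h : ℕ) : ℤ) else (n : ℤ) + 1

/-- Reordering the units, raising treatment outcomes and lowering control outcomes does not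
decrease the one-sided p-value. -/
theorem pOne_le_pOne_of_perm {n m : ℕ} (hmn : m ≤ n) (t : ℚ) {y1 y0 z1 z0 : Fin n → Bool}
    (σ : Equiv.Perm (Fin n)) (h1 : ∀ j, y1 j = true → z1 (σ j) = true)
    (h0 : ∀ j, z0 (σ j) = true → y0 j = true) :
    pOne m t y1 y0 ≤ pOne m t z1 z0 := by
  have h11 (S : Finset (Fin n)) : nObs11 y1 S ≤ nObs11 z1 (S.map σ.toEmbedding) := by
    refine Finset.card_le_card_of_injOn σ (fun j hj => ?_) σ.injective.injOn
    have hj' : j ∈ S ∧ y1 j = true := by simpa using hj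
    simpa using And.intro hj'.1 (h1 j hj'.2)
  have h01 (S : Finset (Fin n)) : nObs01 z0 (S.map σ.toEmbedding) ≤ nObs01 y0 S := by
    refine Finset.card_le_card_of_injOn σ.symm (fun j hj => ?_) σ.symm.injective.injOn
    obtain ⟨i, rfl⟩ := σ.surjective j
    have hj' : i ∉ S ∧ z0 (σ i) = true := by simpa using hj
    simpa using And.intro hj'.1 (h0 i hj'.2)
  have hτ (S : Finset (Fin n)) :
      tauHat m y1 y0 S ≤ tauHat m z1 z0 (S.map σ.toEmbedding) := by
    have hnm : (0 : ℚ) ≤ (n : ℚ) - m := sub_nonneg.2 (by exact_mod_cast hmn)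
    have h11' := h11 S
    have h01' := h01 S
    unfold tauHat
    gcongr
  unfold pOne
  gcongr ?_ / _
  norm_cast
  refine Finset.card_le_card_of_injOn (fun S => S.map σ.toEmbedding) (fun S hS => ?_)
    (Finset.map_injective _).injOn
  have hS' : S.card = m ∧ t ≤ tauHat m y1 y0 S := by simpa using hS
  simpa using And.intro hS'.1 (hS'.2.trans (hτ S))

/-- Moving one unit from the `(0, 0)` cell to the `(1, 0)` cell does not decrease the one-sided
p-value. -/
theorem pOneTable_le_succ {n m : ℕ} (hmn : m ≤ n) (t : ℚ) {N11 k N01 : ℕ} (N00 N00' : ℕ)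
    (h : N11 + (k + 1) + N01 ≤ n) :
    pOneTable n m t N11 k N01 N00 ≤ pOneTable n m t N11 (k + 1) N01 N00' := by
  have ha : N11 + k < n := by lia
  have hb : N11 + k + N01 < n := by lia
  refine pOne_le_pOne_of_perm hmn t (Equiv.swap ⟨N11 + k, ha⟩ ⟨N11 + k + N01, hb⟩)
    (fun j => ?_) (fun j => ?_) <;>
  · simp only [canY1, canY0, decide_eq_true_eq, Equiv.swap_apply_def, Fin.ext_iff]
    split_ifs <;> lia

theorem pOneTable_mono {n m : ℕ} (hmn : m ≤ n) (t : ℚ) {N11 k l N01 : ℕ} (N00 N00' : ℕ)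
    (hkl : k ≤ l) (h : N11 + l + N01 ≤ n) :
    pOneTable n m t N11 k N01 N00 ≤ pOneTable n m t N11 l N01 N00' := by
  induction l, hkl using Nat.le_induction with
  | base => exact le_rfl
  | succ l _ ih => exact (ih (by lia)).trans (pOneTable_le_succ hmn t N00' N00' h)

/-- Theorem A.1(2): a potential table `N` has `p1(N) ≥ α` iff
`N10 ≥ N̲10¹(N11, N01)`. -/
theorem pOne_ge_iff_lowN10One (n m : ℕ) (hm : 0 < m) (hmn : m < n) (α t : ℚ)
    (hα : 0 < α ∧ α < 1) (N11 N10 N01 N00 : ℕ) (hN : N11 + N10 + N01 + N00 = n) :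
    α ≤ pOneTable n m t N11 N10 N01 N00 ↔ lowN10One n m t α N11 N01 ≤ (N10 : ℤ) := by
  unfold lowN10One
  extract_lets s
  have hs (hp : α ≤ pOneTable n m t N11 N10 N01 N00) : N10 ∈ s :=
    Finset.mem_filter.2 ⟨Finset.mem_range.2 (by lia), hp⟩
  split_ifs with h
  · rw [Nat.cast_le]
    refine ⟨fun hp => s.min'_le _ (hs hp), fun hle => ?_⟩
    exact (Finset.mem_filter.1 (s.min'_mem h)).2.trans
      (pOneTable_mono hmn.le t _ _ hle (by lia))
  · exact ⟨fun hp => (h ⟨_, hs hp⟩).elim, fun hle => by lia⟩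
end
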